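/- arXiv:1603.05970 — 3 statements merged into one kernel-verified Lean document; each statement's English description precedes it below -/
import Mathlib

section
/- Let s > 0 and let p be a probability density on ℝ such that the function (x,x') ↦ p(x)p(x')K_s(x,x') is integrable on ℝ². Define q'(y) := ∫_ℝ p(x) φ_1(y − √s·x) dx (the density of √s·X' + G for X' with density p and G an independent standard normal) and q(y) := φ_{1+s}(y). Then 1 + χ²(q', q) = ∫_ℝ ∫_ℝ p(x) p(x') K_s(x,x') dx dx'. -/
open MeasureTheory

/-- The centered real Gaussian density of variance `s`:
`φ_s(x) = (2πs)^{-1/2} exp(−x²/(2s))`. -/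
noncomputable def gaussDensity (s x : ℝ) : ℝ :=
  Real.exp (-(x ^ 2) / (2 * s)) / Real.sqrt (2 * Real.pi * s)

/-- The kernel `K_s(x,x') = ((1+s)/√(1+2s)) · exp[−(s/(2(1+2s)))·(s(x−x')² − 2xx')]`. -/
noncomputable def Kker (s x x' : ℝ) : ℝ :=
  ((1 + s) / Real.sqrt (1 + 2 * s)) *
    Real.exp (-(s / (2 * (1 + 2 * s))) * (s * (x - x') ^ 2 - 2 * x * x'))

/-- The χ²-distance between densities `p` and `q` on ℝ: `χ²(p,q) = ∫ p(y)²/q(y) dy − 1`. -/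
noncomputable def chiSq (p q : ℝ → ℝ) : ℝ := (∫ y : ℝ, (p y) ^ 2 / q y) - 1

lemma gauss_ratio_eq (s : ℝ) (hs : 0 < s) (x x' y : ℝ) :
    gaussDensity 1 (y - Real.sqrt s * x) * gaussDensity 1 (y - Real.sqrt s * x') /
      gaussDensity (1 + s) y =
    (Real.sqrt (2 * Real.pi * (1 + s)) / (2 * Real.pi) *
      Real.exp (-(s / (2 * (1 + 2 * s))) * (s * (x - x') ^ 2 - 2 * x * x'))) *
      Real.exp (-((1 + 2 * s) / (2 * (1 + s))) *
        (y - Real.sqrt s * (x + x') * (1 + s) / (1 + 2 * s)) ^ 2) := by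
  have h1 : (0 : ℝ) < 1 + s := by linarith
  have h2 : (0 : ℝ) < 1 + 2 * s := by linarith
  have hpi := Real.pi_pos
  have e2 : Real.sqrt (2 * Real.pi * 1) * Real.sqrt (2 * Real.pi * 1) = 2 * Real.pi := by
    rw [Real.mul_self_sqrt (by positivity), mul_one]
  obtain ⟨r, hr, hrs⟩ : ∃ r, Real.sqrt s = r ∧ s = r ^ 2 :=
    ⟨_, rfl, (Real.sq_sqrt hs.le).symm⟩
  have key : -((y - Real.sqrt s * x) ^ 2) / (2 * 1) + -((y - Real.sqrt s * x') ^ 2) / (2 * 1)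
      - -(y ^ 2) / (2 * (1 + s)) =
      -(s / (2 * (1 + 2 * s))) * (s * (x - x') ^ 2 - 2 * x * x') +
      -((1 + 2 * s) / (2 * (1 + s))) *
        (y - Real.sqrt s * (x + x') * (1 + s) / (1 + 2 * s)) ^ 2 := by
    rw [hr]
    subst hrs
    field_simp
    ring
  unfold gaussDensity
  rw [mul_assoc (_ / _), ← Real.exp_add, ← key, Real.exp_sub, Real.exp_add, div_mul_div_comm, e2]
  have := Real.exp_pos (-(y ^ 2) / (2 * (1 + s)))
  have h3 : 0 < Real.sqrt (2 * Real.pi * (1 + s)) := Real.sqrt_pos.2 (by positivity)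
  field_simp

lemma gauss_ratio_integrable (s : ℝ) (hs : 0 < s) (x x' : ℝ) :
    Integrable (fun y => gaussDensity 1 (y - Real.sqrt s * x) *
      gaussDensity 1 (y - Real.sqrt s * x') / gaussDensity (1 + s) y) := by
  simp_rw [gauss_ratio_eq s hs x x']
  exact ((integrable_exp_neg_mul_sq (b := (1 + 2 * s) / (2 * (1 + s)))
    (by positivity)).comp_sub_right _).const_mul _

lemma gauss_ratio_integral (s : ℝ) (hs : 0 < s) (x x' : ℝ) :
    ∫ y, gaussDensity 1 (y - Real.sqrt s * x) *
      gaussDensity 1 (y - Real.sqrt s * x') / gaussDensity (1 + s) y = Kker s x x' := by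
  simp_rw [gauss_ratio_eq s hs x x']
  rw [integral_const_mul, integral_sub_right_eq_self
    (fun y => Real.exp (-((1 + 2 * s) / (2 * (1 + s))) * y ^ 2)), integral_gaussian]
  unfold Kker
  rw [mul_right_comm]
  congr 1
  have h1 : (0 : ℝ) < 1 + s := by linarith
  have h2 : (0 : ℝ) < 1 + 2 * s := by linarith
  have hpi := Real.pi_pos
  have : Real.pi / ((1 + 2 * s) / (2 * (1 + s))) = 2 * Real.pi * (1 + s) / (1 + 2 * s) := by
    field_simp
  rw [this, Real.sqrt_div (by positivity), div_mul_div_comm, Real.mul_self_sqrt (by positivity)]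
  have h3 : 0 < Real.sqrt (1 + 2 * s) := Real.sqrt_pos.2 (by positivity)
  field_simp

lemma gaussDensity_measurable (s : ℝ) : Measurable (gaussDensity s) := by
  unfold gaussDensity
  fun_prop

lemma gaussDensity_nonneg (s x : ℝ) : 0 ≤ gaussDensity s x := by
  unfold gaussDensity
  positivity

/-- Lemma 2 of the paper: for `s > 0` and a probability density `p` on ℝ with
`(x,x') ↦ p(x)p(x')K_s(x,x')` integrable, letting `q'` be the density of the AWGN output
`√s·X' + G` (with `X' ∼ p` and `G` standard normal) and `q = φ_{1+s}` the output density
for standard normal input, we have `1 + χ²(q',q) = ∬ p(x)p(x')K_s(x,x') dx dx'`. -/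
theorem one_add_chiSq_eq_double_integral_Kker (s : ℝ) (hs : 0 < s) (p : ℝ → ℝ)
    (hp_meas : Measurable p) (hp_nonneg : ∀ x, 0 ≤ p x) (hp_int : (∫ x : ℝ, p x) = 1)
    (hK : Integrable (fun xx : ℝ × ℝ => p xx.1 * p xx.2 * Kker s xx.1 xx.2))
    (q' q : ℝ → ℝ)
    (hq' : ∀ y, q' y = ∫ x : ℝ, p x * gaussDensity 1 (y - Real.sqrt s * x))
    (hq : ∀ y, q y = gaussDensity (1 + s) y) :
    1 + chiSq q' q = ∫ x : ℝ, ∫ x' : ℝ, p x * p x' * Kker s x x' := by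
  set G : ℝ → ℝ → ℝ → ℝ := fun x x' y => gaussDensity 1 (y - Real.sqrt s * x) *
      gaussDensity 1 (y - Real.sqrt s * x') / gaussDensity (1 + s) y with hG
  have hGn : ∀ x x' y, 0 ≤ G x x' y := fun x x' y =>
    div_nonneg (mul_nonneg (gaussDensity_nonneg _ _) (gaussDensity_nonneg _ _))
      (gaussDensity_nonneg _ _)
  have hGI : ∀ x x', ∫ y, G x x' y = Kker s x x' := gauss_ratio_integral s hs
  have hm1 := gaussDensity_measurable 1
  have hm2 := gaussDensity_measurable (1 + s)
  have hmeas : Measurable (fun z : (ℝ × ℝ) × ℝ => p z.1.1 * p z.1.2 * G z.1.1 z.1.2 z.2) := by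
    simp only [hG]
    fun_prop
  have hF : Integrable (fun z : (ℝ × ℝ) × ℝ => p z.1.1 * p z.1.2 * G z.1.1 z.1.2 z.2)
      ((volume : Measure (ℝ × ℝ)).prod (volume : Measure ℝ)) := by
    rw [integrable_prod_iff hmeas.aestronglyMeasurable]
    refine ⟨Filter.Eventually.of_forall fun z =>
      (gauss_ratio_integrable s hs z.1 z.2).const_mul (p z.1 * p z.2), ?_⟩
    refine hK.congr (Filter.Eventually.of_forall fun z => ?_)
    simp only
    rw [← hGI, ← integral_const_mul]
    refine integral_congr_ae (Filter.Eventually.of_forall fun y => ?_)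
    simp only
    rw [Real.norm_of_nonneg
      (mul_nonneg (mul_nonneg (hp_nonneg _) (hp_nonneg _)) (hGn _ _ _))]
  have hswap := integral_integral_swap
    (f := fun (z : ℝ × ℝ) (y : ℝ) => p z.1 * p z.2 * G z.1 z.2 y) hF
  have hR : ∫ x : ℝ, ∫ x' : ℝ, p x * p x' * Kker s x x' =
      ∫ z : ℝ × ℝ, p z.1 * p z.2 * Kker s z.1 z.2 := (integral_prod _ hK).symm
  rw [hR]
  unfold chiSq
  rw [add_sub_cancel]
  simp_rw [integral_const_mul, hGI] at hswap
  rw [hswap]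
  refine integral_congr_ae (Filter.Eventually.of_forall fun y => ?_)
  simp only
  rw [hq', hq, sq, ← integral_prod_mul, ← integral_div]
  refine integral_congr_ae (Filter.Eventually.of_forall fun z => ?_)
  simp only [hG]
  ring
end

section
/- For every s > 0 and all x, x' ∈ ℝ, the Gaussian integral ∫_ℝ φ_1(y − √s·x) · φ_1(y − √s·x') / φ_{1+s}(y) dy equals K_s(x,x'). -/
open MeasureTheory

/-- For every `s > 0` and all `x, x' ∈ ℝ`, the Gaussian integral
`∫ φ₁(y − √s·x) φ₁(y − √s·x') / φ_{1+s}(y) dy` equals `K_s(x,x')`. -/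
theorem gaussian_integral_eq_Kker (s : ℝ) (hs : 0 < s) (x x' : ℝ) :
    (∫ y : ℝ, gaussDensity 1 (y - Real.sqrt s * x) * gaussDensity 1 (y - Real.sqrt s * x')
        / gaussDensity (1 + s) y)
      = Kker s x x' := by
  have h1 : (0:ℝ) < 1 + s := by linarith
  have h2 : (0:ℝ) < 1 + 2 * s := by linarith
  have hpi := Real.pi_pos
  set r := Real.sqrt s with hr
  have hrs : r ^ 2 = s := Real.sq_sqrt hs.le
  have key : ∀ y : ℝ, gaussDensity 1 (y - r * x) * gaussDensity 1 (y - r * x')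
        / gaussDensity (1 + s) y
      = (Real.sqrt (2 * Real.pi * (1 + s)) / (2 * Real.pi) *
          Real.exp (-(s / (2 * (1 + 2 * s))) * (s * (x - x') ^ 2 - 2 * x * x'))) *
        (fun z : ℝ => Real.exp (-((1 + 2 * s) / (2 * (1 + s))) * z ^ 2))
          (y - r * (x + x') * (1 + s) / (1 + 2 * s)) := by
    intro y
    unfold gaussDensity
    have hsq : Real.sqrt (2 * Real.pi * 1) * Real.sqrt (2 * Real.pi * 1) = 2 * Real.pi := by
      rw [Real.mul_self_sqrt (by positivity)]; ring
    have he : Real.exp (-((y - r * x) ^ 2) / (2 * 1)) * Real.exp (-((y - r * x') ^ 2) / (2 * 1))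
        = Real.exp (-(s / (2 * (1 + 2 * s))) * (s * (x - x') ^ 2 - 2 * x * x')) *
          Real.exp (-((1 + 2 * s) / (2 * (1 + s))) *
            (y - r * (x + x') * (1 + s) / (1 + 2 * s)) ^ 2) *
          Real.exp (-(y ^ 2) / (2 * (1 + s))) := by
      rw [← Real.exp_add, ← Real.exp_add, ← Real.exp_add]
      congr 1
      rw [← hrs] at h1 h2 ⊢
      field_simp
      ring
    rw [div_mul_div_comm, hsq, he]
    have := Real.exp_ne_zero (-(y ^ 2) / (2 * (1 + s)))
    have : Real.sqrt (2 * Real.pi * (1 + s)) ≠ 0 := by positivity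
    field_simp
  simp_rw [key]
  rw [integral_const_mul, integral_sub_right_eq_self
    (fun z : ℝ => Real.exp (-((1 + 2 * s) / (2 * (1 + s))) * z ^ 2)), integral_gaussian]
  have e : Real.pi / ((1 + 2 * s) / (2 * (1 + s))) = (2 * Real.pi * (1 + s)) / (1 + 2 * s) := by
    field_simp
  have hq : Real.sqrt (2 * Real.pi * (1 + s)) ^ 2 = 2 * Real.pi * (1 + s) :=
    Real.sq_sqrt (by positivity)
  rw [e, Real.sqrt_div (by positivity)]
  unfold Kker
  have : Real.sqrt (1 + 2 * s) ≠ 0 := by positivity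
  field_simp
  rw [hq]
end

section
/- Let s > 0 and let p be a probability density on ℝ whose moments of all orders exist, such that Σ_{k=0}^∞ (1/k!)(s/(1+s))^k (∫ H_k(x) p(x) dx)² < ∞ and the relevant integrals converge. Define q'(y) := ∫_ℝ p(x) φ_1(y − √s·x) dx and q(y) := φ_{1+s}(y). Then 1 + χ²(q', q) = Σ_{k=0}^∞ (1/k!) · (s/(1+s))^k · ( ∫_ℝ H_k(x) p(x) dx )², where H_k is the k-th probabilists' Hermite polynomial. In particular, since ∫ H_k(x) φ_1(x) dx = 0 for all k ≥ 1 and equals 1 for k = 0, the right-hand side equals 1 when p = φ_1. -/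
open MeasureTheory

/-- The `k`-th probabilists' Hermite polynomial, evaluated at `x : ℝ`. -/
noncomputable def hermiteEval (k : ℕ) (x : ℝ) : ℝ :=
  Polynomial.aeval x (Polynomial.hermite k)


namespace WV

open Polynomial ProbabilityTheory

/-- The standard Gaussian measure. -/
noncomputable abbrev gam : Measure ℝ := gaussianReal 0 1

/-- Hermite polynomials with real coefficients. -/
noncomputable def Hr (n : ℕ) : ℝ[X] := (hermite n).map (Int.castRingHom ℝ)

lemma hermiteEval_eq (n : ℕ) (x : ℝ) : hermiteEval n x = (Hr n).eval x := by
  rw [hermiteEval, Hr, eval_map, aeval_def]; rfl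

lemma Hr_zero : Hr 0 = 1 := by simp [Hr]

lemma Hr_succ (n : ℕ) : Hr (n + 1) = X * Hr n - derivative (Hr n) := by
  simp [Hr, hermite_succ, derivative_map]

lemma Hr_monic (n : ℕ) : (Hr n).Monic := (hermite_monic n).map _

lemma Hr_natDegree (n : ℕ) : (Hr n).natDegree = n := by
  rw [Hr, (hermite_monic n).natDegree_map, natDegree_hermite]

lemma Hr_deriv (n : ℕ) : derivative (Hr (n + 1)) = C ((n : ℝ) + 1) * Hr n := by
  induction n with
  | zero => simp [Hr_succ, Hr_zero]
  | succ n ih =>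
    rw [Hr_succ (n + 1), derivative_sub, derivative_mul, ih, derivative_mul, Hr_succ n]
    simp
    ring

lemma gam_pdf (x : ℝ) : gaussianPDFReal 0 1 x = gaussDensity 1 x := by
  simp [gaussianPDFReal, gaussDensity, div_eq_inv_mul]

lemma integral_gam (f : ℝ → ℝ) : ∫ x, f x ∂gam = ∫ x, gaussDensity 1 x * f x := by
  rw [integral_gaussianReal_eq_integral_smul (by simp)]
  simp [gam_pdf]

lemma gam_eq : gam = volume.withDensity (fun x => ENNReal.ofReal (gaussDensity 1 x)) := by
  rw [gam, gaussianReal_of_var_ne_zero _ (by simp)]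
  congr 1
  ext x
  simp [gaussianPDF, gam_pdf]

lemma gd_pos (x : ℝ) : 0 < gaussDensity 1 x := by
  rw [gaussDensity]; positivity

lemma gd_cont : Continuous (gaussDensity 1) := by
  unfold gaussDensity; fun_prop

lemma integrable_gam_iff (f : ℝ → ℝ) :
    Integrable f gam ↔ Integrable (fun x => gaussDensity 1 x * f x) := by
  rw [gam_eq, integrable_withDensity_iff_integrable_smul' (by have := gd_cont; fun_prop) (by simp)]
  simp [ENNReal.toReal_ofReal (gd_pos _).le]

lemma integrable_poly (P : ℝ[X]) : Integrable (fun x => P.eval x) gam := by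
  induction P using Polynomial.induction_on' with
  | add p q hp hq => simpa using! hp.add hq
  | monomial n a =>
    simp only [eval_monomial]
    apply Integrable.const_mul
    exact integrable_pow_of_mem_interior_integrableExpSet (X := id) (by simp) n

lemma memLp_poly (P : ℝ[X]) : MemLp (fun x => P.eval x) 2 gam := by
  rw [memLp_two_iff_integrable_sq P.continuous.aestronglyMeasurable]
  have h := integrable_poly (P ^ 2)
  simp only [eval_pow] at h
  exact h

lemma gd_deriv (x : ℝ) : HasDerivAt (gaussDensity 1) (-x * gaussDensity 1 x) x := by
  unfold gaussDensity
  have : HasDerivAt (fun x : ℝ => -(x ^ 2) / (2 * 1)) (-x) x := by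
    refine ((hasDerivAt_pow 2 x).neg.div_const (2 * 1)).congr_deriv ?_
    simp; ring
  refine (this.exp.div_const (Real.sqrt (2 * Real.pi * 1))).congr_deriv ?_
  ring

/-- Stein's identity for polynomials. -/
lemma stein (P : ℝ[X]) : ∫ x, x * P.eval x ∂gam = ∫ x, (derivative P).eval x ∂gam := by
  have h1 := integrable_poly (derivative P)
  have h2 := integrable_poly (X * P)
  have h3 := integrable_poly P
  have i1 : Integrable (fun x => gaussDensity 1 x * (derivative P - X * P).eval x) :=
    (integrable_gam_iff (fun x => (derivative P - X * P).eval x)).1 (integrable_poly _)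
  have i2 : Integrable (fun x => gaussDensity 1 x * P.eval x) :=
    (integrable_gam_iff (fun x => P.eval x)).1 h3
  have h := integral_eq_zero_of_hasDerivAt_of_integrable
    (f := fun x => gaussDensity 1 x * P.eval x)
    (f' := fun x => gaussDensity 1 x * (derivative P - X * P).eval x) ?_
    i1 i2
  · rw [← integral_gam] at h
    simp only [eval_sub, eval_mul, eval_X] at h h2
    rw [integral_sub h1 h2] at h
    linarith
  · intro x
    refine ((gd_deriv x).mul (P.hasDerivAt x)).congr_deriv ?_
    simp; ring

lemma inner_Hr (n : ℕ) : ∀ P : ℝ[X], ∫ x, (Hr n).eval x * P.eval x ∂gam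
    = ∫ x, (derivative^[n] P).eval x ∂gam := by
  induction n with
  | zero => intro P; simp [Hr_zero]
  | succ n ih =>
    intro P
    have h := stein (Hr n * P)
    rw [Function.iterate_succ_apply, ← ih]
    have e1 : ∀ x, (Hr (n + 1)).eval x * P.eval x =
        (X * (Hr n * P)).eval x - (derivative (Hr n) * P).eval x := by
      intro x; simp [Hr_succ]; ring
    have e2 : ∀ x, (Hr n).eval x * (derivative P).eval x =
        (derivative (Hr n * P)).eval x - (derivative (Hr n) * P).eval x := by
      intro x; simp
    simp_rw [e1, e2]
    rw [integral_sub (integrable_poly _) (integrable_poly _),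
      integral_sub (integrable_poly _) (integrable_poly _), ← h]
    simp

lemma ortho_lt {m n : ℕ} (h : m < n) : ∫ x, (Hr n).eval x * (Hr m).eval x ∂gam = 0 := by
  rw [inner_Hr, iterate_derivative_eq_zero (by rwa [Hr_natDegree])]
  simp

lemma ortho_ne {m n : ℕ} (h : m ≠ n) : ∫ x, (Hr n).eval x * (Hr m).eval x ∂gam = 0 := by
  rcases lt_or_gt_of_ne h with h | h
  · exact ortho_lt h
  · simp_rw [mul_comm]; exact ortho_lt h

lemma iter_deriv_Hr (n : ℕ) : derivative^[n] (Hr n) = C (n.factorial : ℝ) := by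
  induction n with
  | zero => simp [Hr_zero]
  | succ n ih =>
    rw [Function.iterate_succ_apply, Hr_deriv, iterate_derivative_C_mul, ih, ← C_mul]
    simp [Nat.factorial_succ]

lemma ortho_self (n : ℕ) : ∫ x, (Hr n).eval x * (Hr n).eval x ∂gam = n.factorial := by
  rw [inner_Hr, iter_deriv_Hr]
  simp

/-- Mehler semigroup acting on Hermite polynomials. -/
lemma mehler (ρ σ : ℝ) (h : ρ ^ 2 + σ ^ 2 = 1) (n : ℕ) (x : ℝ) :
    ∫ g, (Hr n).eval (ρ * x + σ * g) ∂gam = ρ ^ n * (Hr n).eval x := by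
  have ipoly : ∀ P : ℝ[X], ∀ g, P.eval (ρ * x + σ * g) = (P.comp (C (ρ * x) + C σ * X)).eval g := by
    intro P g; simp
  have step : ∀ P : ℝ[X], ∫ g, (X * P - derivative P).eval (ρ * x + σ * g) ∂gam =
      ρ * x * ∫ g, P.eval (ρ * x + σ * g) ∂gam
        - ρ ^ 2 * ∫ g, (derivative P).eval (ρ * x + σ * g) ∂gam := by
    intro P
    have hst := stein (P.comp (C (ρ * x) + C σ * X))
    have hd : derivative (P.comp (C (ρ * x) + C σ * X)) =
        C σ * ((derivative P).comp (C (ρ * x) + C σ * X)) := by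
      rw [derivative_comp]; simp
    rw [hd] at hst
    simp only [eval_mul, eval_C, ← ipoly] at hst
    rw [integral_const_mul] at hst
    have i1 : Integrable (fun g => P.eval (ρ * x + σ * g)) gam := by
      simp_rw [ipoly]; exact integrable_poly _
    have i2 : Integrable (fun g => (derivative P).eval (ρ * x + σ * g)) gam := by
      simp_rw [ipoly]; exact integrable_poly _
    have i3 : Integrable (fun g => g * P.eval (ρ * x + σ * g)) gam := by
      have := integrable_poly (X * (P.comp (C (ρ * x) + C σ * X)))
      simp_rw [ipoly]; simpa using this
    have e : ∀ g, (X * P - derivative P).eval (ρ * x + σ * g) =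
        (ρ * x * P.eval (ρ * x + σ * g) + σ * (g * P.eval (ρ * x + σ * g)))
          - (derivative P).eval (ρ * x + σ * g) := by
      intro g; simp; ring
    simp_rw [e]
    have i4 : Integrable (fun g => ρ * x * P.eval (ρ * x + σ * g)
        + σ * (g * P.eval (ρ * x + σ * g))) gam := (i1.const_mul _).add (i3.const_mul _)
    rw [integral_sub i4 i2,
      integral_add (i1.const_mul _) (i3.const_mul _), integral_const_mul, integral_const_mul, hst]
    have : ρ ^ 2 = 1 - σ ^ 2 := by linarith
    rw [this]; ring
  induction n using Nat.strong_induction_on with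
  | _ n ih =>
    match n with
    | 0 => simp [Hr_zero]
    | 1 =>
      have := step 1
      rw [Hr_succ, Hr_zero, this]; simp
    | n + 2 =>
      rw [Hr_succ (n + 1), step, ih (n + 1) (by omega), Hr_deriv]
      simp only [eval_mul, eval_C, integral_const_mul]
      rw [ih n (by omega)]
      simp; ring

end WV

namespace WV

open Polynomial ProbabilityTheory

lemma memLp_exp_abs (t : ℝ) : MemLp (fun x : ℝ => Real.exp |t * x|) 2 gam := by
  rw [memLp_two_iff_integrable_sq (by fun_prop)]
  have h := integrable_exp_mul_abs (X := fun x : ℝ => x) (μ := gam) (t := 2 * |t|)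
    (integrable_exp_mul_gaussianReal _) (integrable_exp_mul_gaussianReal _)
  refine h.congr (Filter.Eventually.of_forall fun x => ?_)
  simp only [← Real.exp_nat_mul, abs_mul]
  congr 1
  push_cast
  ring

/-- A function in `L²(γ)` orthogonal to all monomials is a.e. zero. -/
lemma complete_monomial (f : ℝ → ℝ) (hf : MemLp f 2 gam)
    (h : ∀ n : ℕ, ∫ x, f x * x ^ n ∂gam = 0) : f =ᵐ[gam] 0 := by
  have hfi : Integrable f gam := hf.integrable (by norm_num)
  have key : ∀ t : ℝ, ∫ x, (f x : ℂ) * Complex.exp (t * x * Complex.I) ∂gam = 0 := by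
    intro t
    have hs : HasSum (fun n : ℕ => ∫ x, (f x : ℂ) * ((t * x * Complex.I) ^ n / n.factorial) ∂gam)
        (∫ x, (f x : ℂ) * Complex.exp (t * x * Complex.I) ∂gam) := by
      refine hasSum_integral_of_dominated_convergence
        (fun n x => |f x| * (|t * x| ^ n / n.factorial)) ?_ ?_ ?_ ?_ ?_
      · intro n
        refine AEStronglyMeasurable.mul ?_ (by fun_prop)
        exact Complex.continuous_ofReal.comp_aestronglyMeasurable hf.1
      · intro n
        refine Filter.Eventually.of_forall fun x => ?_
        simp [abs_mul]
      · refine Filter.Eventually.of_forall fun x => ?_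
        exact (Real.summable_pow_div_factorial _).mul_left _
      · have : (fun x => ∑' n : ℕ, |f x| * (|t * x| ^ n / n.factorial))
            = fun x => |f x| * Real.exp |t * x| := by
          ext x
          rw [tsum_mul_left, Real.exp_eq_exp_ℝ, NormedSpace.exp_eq_tsum_div]
        rw [this]
        exact hf.abs.integrable_mul (memLp_exp_abs t)
      · refine Filter.Eventually.of_forall fun x => ?_
        rw [Complex.exp_eq_exp_ℂ]
        exact (NormedSpace.expSeries_div_hasSum_exp (𝔸 := ℂ) _).mul_left _
    have hz : ∀ n : ℕ, ∫ x, (f x : ℂ) * ((t * x * Complex.I) ^ n / n.factorial) ∂gam = 0 := by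
      intro n
      have e : ∀ x : ℝ, (f x : ℂ) * ((t * x * Complex.I) ^ n / n.factorial) =
          ((t * Complex.I) ^ n / n.factorial) * ((f x * x ^ n : ℝ) : ℂ) := by
        intro x; push_cast; ring
      simp_rw [e]
      rw [integral_const_mul, integral_complex_ofReal, h n]
      simp
    simp_rw [hz] at hs
    exact hs.unique hasSum_zero
  have fin1 : IsFiniteMeasure (gam.withDensity fun x => ENNReal.ofReal (f x)) :=
    isFiniteMeasure_withDensity_ofReal hfi.2
  have fin2 : IsFiniteMeasure (gam.withDensity fun x => ENNReal.ofReal (-f x)) :=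
    isFiniteMeasure_withDensity_ofReal hfi.neg.2
  have m1 : AEMeasurable (fun x => ENNReal.ofReal (f x)) gam := hf.1.aemeasurable.ennreal_ofReal
  have m2 : AEMeasurable (fun x => ENNReal.ofReal (-f x)) gam :=
    hf.1.aemeasurable.neg.ennreal_ofReal
  have heq : (gam.withDensity fun x => ENNReal.ofReal (f x)) =
      gam.withDensity fun x => ENNReal.ofReal (-f x) := by
    apply Measure.ext_of_charFun
    ext t
    rw [charFun_apply_real, charFun_apply_real,
      integral_withDensity_eq_integral_toReal_smul₀ m1 (by simp),
      integral_withDensity_eq_integral_toReal_smul₀ m2 (by simp), ← sub_eq_zero]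
    have ib : ∀ g : ℝ → ℝ, Integrable g gam →
        Integrable (fun x => g x • Complex.exp (t * x * Complex.I)) gam := by
      intro g hg
      refine Integrable.mono hg ?_ (Filter.Eventually.of_forall fun x => ?_)
      · exact hg.1.smul (by fun_prop)
      · rw [norm_smul]
        have : ‖Complex.exp (t * x * Complex.I)‖ = 1 := by
          have := Complex.norm_exp_ofReal_mul_I (t * x)
          simpa using this
        simp [this]
    rw [← integral_sub, ← key t]
    · congr 1
      ext x
      rw [← sub_smul, Complex.real_smul]
      congr 2
      rw [ENNReal.toReal_ofReal', ENNReal.toReal_ofReal']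
      rcases le_total 0 (f x) with h0 | h0
      · rw [max_eq_left h0, max_eq_right (by linarith)]; ring
      · rw [max_eq_right h0, max_eq_left (by linarith)]; ring
    · apply ib
      simp_rw [ENNReal.toReal_ofReal']
      exact hfi.pos_part
    · apply ib
      simp_rw [ENNReal.toReal_ofReal']
      exact hfi.neg.pos_part
  rw [withDensity_eq_iff_of_sigmaFinite m1 m2] at heq
  filter_upwards [heq] with x hx
  rcases le_total 0 (f x) with h0 | h0
  · rw [ENNReal.ofReal_of_nonpos (p := -f x) (by linarith), ENNReal.ofReal_eq_zero] at hx
    exact le_antisymm hx h0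
  · rw [ENNReal.ofReal_of_nonpos (p := f x) (by linarith), eq_comm, ENNReal.ofReal_eq_zero] at hx
    exact le_antisymm h0 (neg_nonpos.1 hx)

lemma int_mul_poly (f : ℝ → ℝ) (hf : MemLp f 2 gam) (P : ℝ[X]) :
    Integrable (fun x => f x * P.eval x) gam := hf.integrable_mul (memLp_poly P)

lemma complete_hermite (f : ℝ → ℝ) (hf : MemLp f 2 gam)
    (h : ∀ n : ℕ, ∫ x, f x * (Hr n).eval x ∂gam = 0) : f =ᵐ[gam] 0 := by
  have all : ∀ n : ℕ, ∀ P : ℝ[X], P.degree < n → ∫ x, f x * P.eval x ∂gam = 0 := by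
    intro n
    induction n with
    | zero =>
      intro P hP
      have : P = 0 := by
        rw [← degree_eq_bot]
        simpa using hP
      simp [this]
    | succ n ih =>
      intro P hP
      have hQ : (P - C (P.coeff n) * Hr n).degree < n := by
        rw [degree_lt_iff_coeff_zero]
        intro m hm
        rcases hm.eq_or_lt with rfl | hm
        · have : (Hr n).coeff n = 1 := by
            have := Hr_monic n
            rwa [Monic, leadingCoeff, Hr_natDegree] at this
          simp [this]
        · have h1 : P.coeff m = 0 := by
            rw [degree_lt_iff_coeff_zero] at hP
            exact hP m hm
          have h2 : (Hr n).coeff m = 0 :=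
            coeff_eq_zero_of_natDegree_lt (by rwa [Hr_natDegree])
          simp [h1, h2]
      have h3 := ih _ hQ
      have e : ∀ x, f x * (P - C (P.coeff n) * Hr n).eval x =
          f x * P.eval x - P.coeff n * (f x * (Hr n).eval x) := by
        intro x; simp; ring
      simp_rw [e] at h3
      rw [integral_sub (int_mul_poly f hf P) ((int_mul_poly f hf _).const_mul _),
        integral_const_mul, h n] at h3
      simpa using h3
  refine complete_monomial f hf fun n => ?_
  have := all (n + 1) (X ^ n) (by rw [degree_X_pow]; exact_mod_cast Nat.lt_succ_self n)
  simpa using this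

/-- Normalized Hermite polynomials as elements of `L²(γ)`. -/
noncomputable def hL (n : ℕ) : Lp ℝ 2 gam :=
  MemLp.toLp (fun x => (Hr n).eval x / Real.sqrt n.factorial)
    (by simpa [div_eq_mul_inv] using (memLp_poly (Hr n)).mul_const (Real.sqrt n.factorial)⁻¹)

lemma hL_coe (n : ℕ) : hL n =ᵐ[gam] fun x => (Hr n).eval x / Real.sqrt n.factorial :=
  MemLp.coeFn_toLp _

lemma inner_hL (f : Lp ℝ 2 gam) (n : ℕ) :
    inner ℝ f (hL n) = (∫ x, f x * (Hr n).eval x ∂gam) / Real.sqrt n.factorial := by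
  rw [L2.inner_def, ← integral_div]
  refine integral_congr_ae ?_
  filter_upwards [hL_coe n] with x hx
  simp [hx]; ring

lemma hL_orthonormal : Orthonormal ℝ hL := by
  classical
  rw [orthonormal_iff_ite]
  intro i j
  rw [inner_hL]
  have : ∫ x, (hL i : ℝ → ℝ) x * (Hr j).eval x ∂gam =
      (∫ x, (Hr i).eval x * (Hr j).eval x ∂gam) / Real.sqrt i.factorial := by
    rw [← integral_div]
    refine integral_congr_ae ?_
    filter_upwards [hL_coe i] with x hx
    rw [hx]; ring
  rw [this]
  split_ifs with hij
  · subst hij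
    rw [ortho_self, div_div, Real.mul_self_sqrt (by positivity), div_self (by positivity)]
  · rw [ortho_ne (Ne.symm hij)]; simp

lemma hL_complete : (Submodule.span ℝ (Set.range hL))ᗮ = ⊥ := by
  rw [eq_bot_iff]
  intro f hf
  rw [Submodule.mem_orthogonal'] at hf
  have h0 : ∀ n, ∫ x, f x * (Hr n).eval x ∂gam = 0 := by
    intro n
    have := hf (hL n) (Submodule.subset_span ⟨n, rfl⟩)
    rw [inner_hL, div_eq_zero_iff] at this
    rcases this with h | h
    · exact h
    · exact absurd h (by positivity)
  rw [Submodule.mem_bot]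
  exact (Lp.eq_zero_iff_ae_eq_zero).2 (complete_hermite f (Lp.memLp f) h0)

/-- Parseval for Hermite expansion in `L²(γ)`. -/
lemma parseval (f : ℝ → ℝ) (hf : MemLp f 2 gam) :
    HasSum (fun n : ℕ => (1 / (n.factorial : ℝ)) * (∫ x, f x * (Hr n).eval x ∂gam) ^ 2)
      (∫ x, f x ^ 2 ∂gam) := by
  have h := (HilbertBasis.mkOfOrthogonalEqBot hL_orthonormal hL_complete).hasSum_inner_mul_inner
    (hf.toLp f) (hf.toLp f)
  have hc := hf.coeFn_toLp
  have e2 : inner ℝ (hf.toLp f) (hf.toLp f) = ∫ x, f x ^ 2 ∂gam := by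
    rw [L2.inner_def]
    refine integral_congr_ae ?_
    filter_upwards [hc] with x hx
    simp [hx, sq]
  rw [e2] at h
  convert! h using 1
  ext n
  rw [HilbertBasis.coe_mkOfOrthogonalEqBot, real_inner_comm, real_inner_comm, ← sq, inner_hL]
  have : ∫ x, (hf.toLp f : ℝ → ℝ) x * (Hr n).eval x ∂gam = ∫ x, f x * (Hr n).eval x ∂gam := by
    refine integral_congr_ae ?_
    filter_upwards [hc] with x hx
    rw [hx]
  rw [this, div_pow, Real.sq_sqrt (by positivity)]; ring

end WV

namespace WV

open Polynomial ProbabilityTheory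

lemma shear (F : ℝ × ℝ → ℝ) (hF : Measurable F) (a : ℝ)
    (h : Integrable F (volume.prod volume)) :
    Integrable (fun z : ℝ × ℝ => F (z.1, z.2 - a * z.1)) (volume.prod volume) := by
  rw [integrable_prod_iff hF.aestronglyMeasurable] at h
  rw [integrable_prod_iff (Measurable.aestronglyMeasurable (by fun_prop))]
  refine ⟨?_, ?_⟩
  · filter_upwards [h.1] with x hx
    exact hx.comp_sub_right (a * x)
  · refine h.2.congr (Filter.Eventually.of_forall fun x => ?_)
    exact (integral_sub_right_eq_self (fun y => ‖F (x, y)‖) (a * x)).symm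

lemma int_two (p : ℝ → ℝ) (hp_meas : Measurable p) (hp_nonneg : ∀ x, 0 ≤ p x)
    (hmom : ∀ m : ℕ, Integrable (fun x : ℝ => |x| ^ m * p x)) (ρ σ : ℝ) (P : ℝ[X]) :
    Integrable (fun z : ℝ × ℝ => p z.1 * (gaussDensity 1 z.2 * P.eval (ρ * z.1 + σ * z.2)))
      (volume.prod volume) := by
  induction P using Polynomial.induction_on' with
  | add P Q hP hQ =>
    refine (hP.add hQ).congr (Filter.Eventually.of_forall fun z => ?_)
    simp; ring
  | monomial n a =>
    have hx : ∀ k : ℕ, Integrable (fun x : ℝ => p x * x ^ k) := by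
      intro k
      refine (hmom k).mono' (by fun_prop) (Filter.Eventually.of_forall fun x => ?_)
      rw [norm_mul, norm_pow, Real.norm_eq_abs, Real.norm_eq_abs, abs_of_nonneg (hp_nonneg x),
        mul_comm]
    have hg : ∀ k : ℕ, Integrable (fun x : ℝ => gaussDensity 1 x * x ^ k) := by
      intro k
      have := (integrable_gam_iff _).1 (integrable_poly (X ^ k : ℝ[X]))
      simpa using this
    have hs : Integrable (fun z : ℝ × ℝ => ∑ k ∈ Finset.range (n + 1),
        (a * ρ ^ k * σ ^ (n - k) * (n.choose k : ℝ)) *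
          ((p z.1 * z.1 ^ k) * (gaussDensity 1 z.2 * z.2 ^ (n - k)))) (volume.prod volume) :=
      integrable_finsetSum _ fun k _ => ((hx k).mul_prod (hg (n - k))).const_mul _
    refine hs.congr (Filter.Eventually.of_forall fun z => ?_)
    simp only [eval_monomial, add_pow, Finset.mul_sum]
    refine Finset.sum_congr rfl fun k _ => ?_
    rw [mul_pow, mul_pow]; ring

lemma coeff_formula (s : ℝ) (hs : 0 < s) (p : ℝ → ℝ)
    (hp_meas : Measurable p) (hp_nonneg : ∀ x, 0 ≤ p x)
    (hmom : ∀ m : ℕ, Integrable (fun x : ℝ => |x| ^ m * p x)) (n : ℕ) :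
    ∫ y, (∫ x : ℝ, p x * gaussDensity 1 (y - Real.sqrt s * x)) *
      (Hr n).eval (y / Real.sqrt (1 + s)) =
      (Real.sqrt s / Real.sqrt (1 + s)) ^ n * ∫ x, (Hr n).eval x * p x := by
  set c := Real.sqrt (1 + s) with hc
  have hc0 : 0 < c := Real.sqrt_pos.2 (by linarith)
  have hc2 : c ^ 2 = 1 + s := Real.sq_sqrt (by linarith)
  have hs2 : Real.sqrt s ^ 2 = s := Real.sq_sqrt hs.le
  set ρ := Real.sqrt s / c with hρ
  have hrs : ρ ^ 2 + (1 / c) ^ 2 = 1 := by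
    rw [hρ, div_pow, div_pow, hs2, hc2]; field_simp; ring
  have i1 := int_two p hp_meas hp_nonneg hmom ρ (1 / c) (Hr n)
  have gm := gd_cont.measurable
  have pm := (Hr n).continuous.measurable
  have i2 := shear _ (by fun_prop) (Real.sqrt s) i1
  calc _ = ∫ y, ∫ x, p x * (gaussDensity 1 (y - Real.sqrt s * x) *
        (Hr n).eval (ρ * x + 1 / c * (y - Real.sqrt s * x))) := by
        congr 1; ext y
        rw [← integral_mul_const]
        congr 1; ext x
        have : ρ * x + 1 / c * (y - Real.sqrt s * x) = y / c := by rw [hρ]; field_simp; ring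
        rw [this]; ring
    _ = ∫ x, ∫ y, p x * (gaussDensity 1 (y - Real.sqrt s * x) *
        (Hr n).eval (ρ * x + 1 / c * (y - Real.sqrt s * x))) :=
        (integral_integral_swap (f := fun x y => p x * (gaussDensity 1 (y - Real.sqrt s * x) *
        (Hr n).eval (ρ * x + 1 / c * (y - Real.sqrt s * x)))) i2).symm
    _ = ∫ x, ρ ^ n * ((Hr n).eval x * p x) := by
        congr 1; ext x
        rw [integral_sub_right_eq_self (fun g => p x * (gaussDensity 1 g *
          (Hr n).eval (ρ * x + 1 / c * g))) (Real.sqrt s * x), integral_const_mul, ← integral_gam,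
          mehler ρ (1 / c) hrs]
        ring
    _ = _ := integral_const_mul _ _

end WV

/-- The Wu–Verdú identity: for the AWGN channel with signal-to-noise ratio `s` and input
density `p`, `1 + χ²(q',q) = Σ_k (1/k!)(s/(1+s))^k (E[H_k(X')])²` where `H_k` is the `k`-th
probabilists' Hermite polynomial; in particular, the right-hand side equals `1` when `p = φ₁`,
since `∫ H_k φ₁ = 0` for `k ≥ 1` and `= 1` for `k = 0`. -/
theorem wu_verdu_chiSq_hermite (s : ℝ) (hs : 0 < s) (p : ℝ → ℝ)
    (hp_meas : Measurable p) (hp_nonneg : ∀ x, 0 ≤ p x) (hp_int : (∫ x : ℝ, p x) = 1)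
    (hmom : ∀ m : ℕ, Integrable (fun x : ℝ => |x| ^ m * p x))
    (hsum : Summable (fun m : ℕ => (1 / (Nat.factorial m : ℝ)) * (s / (1 + s)) ^ m *
      (∫ x : ℝ, hermiteEval m x * p x) ^ 2))
    (q' q : ℝ → ℝ)
    (hq' : ∀ y, q' y = ∫ x : ℝ, p x * gaussDensity 1 (y - Real.sqrt s * x))
    (hq : ∀ y, q y = gaussDensity (1 + s) y)
    (hint : Integrable (fun y : ℝ => (q' y) ^ 2 / q y)) :
    (1 + chiSq q' q = ∑' m : ℕ, (1 / (Nat.factorial m : ℝ)) * (s / (1 + s)) ^ m *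
        (∫ x : ℝ, hermiteEval m x * p x) ^ 2) ∧
    ((∀ x, p x = gaussDensity 1 x) →
      (∑' m : ℕ, (1 / (Nat.factorial m : ℝ)) * (s / (1 + s)) ^ m *
        (∫ x : ℝ, hermiteEval m x * p x) ^ 2) = 1) := by
  have hc0 : 0 < Real.sqrt (1 + s) := Real.sqrt_pos.2 (by linarith)
  have hc2 : Real.sqrt (1 + s) ^ 2 = 1 + s := Real.sq_sqrt (by linarith)
  have hs2 : Real.sqrt s ^ 2 = s := Real.sq_sqrt hs.le
  have gm := WV.gd_cont.measurable
  simp only [WV.hermiteEval_eq]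
  constructor
  · have hq'm : Measurable q' := by
      have : StronglyMeasurable
          (fun y => ∫ x : ℝ, p x * gaussDensity 1 (y - Real.sqrt s * x)) := by
        apply StronglyMeasurable.integral_prod_right
          (f := fun y x => p x * gaussDensity 1 (y - Real.sqrt s * x))
        apply Measurable.stronglyMeasurable
        unfold Function.uncurry
        fun_prop
      rw [show q' = _ from funext hq']
      exact this.measurable
    have hqc : ∀ z, q (Real.sqrt (1 + s) * z) = gaussDensity 1 z / Real.sqrt (1 + s) := by
      intro z
      rw [hq, gaussDensity, gaussDensity, mul_pow, hc2, Real.sqrt_mul (by positivity), div_div,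
        mul_one, mul_one]
      congr 2
      field_simp
    set c := Real.sqrt (1 + s) with hc
    set F : ℝ → ℝ := fun z => c * q' (c * z) / gaussDensity 1 z with hF
    have hFm : Measurable F := by rw [hF]; fun_prop
    have e1 : ∀ z, gaussDensity 1 z * F z ^ 2 = c * (q' (c * z) ^ 2 / q (c * z)) := by
      intro z
      have := (WV.gd_pos z).ne'
      rw [hqc, hF]; field_simp
    have hF2 : MemLp F 2 WV.gam := by
      rw [memLp_two_iff_integrable_sq hFm.aestronglyMeasurable, WV.integrable_gam_iff]
      simp_rw [e1]
      exact (hint.comp_mul_left' hc0.ne').const_mul c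
    have hF3 : ∫ z, F z ^ 2 ∂WV.gam = ∫ y, q' y ^ 2 / q y := by
      rw [WV.integral_gam]
      simp_rw [e1]
      rw [integral_const_mul, Measure.integral_comp_mul_left (fun y => q' y ^ 2 / q y) c,
        abs_of_pos (inv_pos.2 hc0), smul_eq_mul, mul_inv_cancel_left₀ hc0.ne']
    have hF4 : ∀ n, ∫ z, F z * (WV.Hr n).eval z ∂WV.gam =
        (Real.sqrt s / c) ^ n * ∫ x, (WV.Hr n).eval x * p x := by
      intro n
      rw [← WV.coeff_formula s hs p hp_meas hp_nonneg hmom n, WV.integral_gam]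
      simp_rw [← hq']
      have : ∀ z, gaussDensity 1 z * (F z * (WV.Hr n).eval z) =
          c * (q' (c * z) * (WV.Hr n).eval (c * z / c)) := by
        intro z
        have := (WV.gd_pos z).ne'
        rw [mul_div_cancel_left₀ _ hc0.ne', hF]; field_simp
      simp_rw [this]
      rw [integral_const_mul,
        Measure.integral_comp_mul_left (fun y => q' y * (WV.Hr n).eval (y / c)) c,
        abs_of_pos (inv_pos.2 hc0), smul_eq_mul, mul_inv_cancel_left₀ hc0.ne']
    have hP := (WV.parseval F hF2).tsum_eq
    rw [hF3] at hP
    rw [chiSq, add_sub_cancel, ← hP]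
    congr 1
    ext n
    rw [hF4, mul_pow, ← pow_mul, mul_comm n 2, pow_mul, div_pow, hs2, hc2]
    ring
  · intro hpe
    have h0 : ∀ m, ∫ x, (WV.Hr m).eval x * p x = if m = 0 then 1 else 0 := by
      intro m
      have e : ∫ x, (WV.Hr m).eval x * p x = ∫ x, (WV.Hr m).eval x * (WV.Hr 0).eval x ∂WV.gam := by
        rw [WV.integral_gam]
        congr 1; ext x
        rw [hpe, WV.Hr_zero]; simp [mul_comm]
      rw [e]
      split_ifs with hm
      · subst hm; rw [WV.ortho_self]; simp
      · exact WV.ortho_ne (Ne.symm hm)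
    rw [tsum_eq_single 0]
    · rw [h0]; simp
    · intro m hm
      rw [h0, if_neg hm]; simp
end
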